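/- Let D₁, …, D_k (k ≥ 2) be pairwise vertex-disjoint digraphs each containing a Hamiltonian cycle, and let D be a generalized sum of them. If D is strong and contains no good cycle, then D is vertex-pancyclic. -/

import Mathlib

/-- A directed cycle of length `k` passing through `v`. -/
def CycleThru {V : Type*} (A : V → V → Prop) (k : ℕ) (v : V) : Prop :=
  ∃ z : ZMod k → V, Function.Injective z ∧ (∀ i, A (z i) (z (i + 1))) ∧ ∃ i, z i = v

/-- Generalized sum with vertex set `U` of the family of parts `S i`. -/
def GenSumFam {V ι : Type*} (A : V → V → Prop) (U : Set V) (S : ι → Set V) : Prop :=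
  (Pairwise fun i j => Disjoint (S i) (S j)) ∧ (⋃ i, S i) = U ∧
    ∀ i j, i ≠ j → ∀ u ∈ S i, ∀ v ∈ S j, Xor' (A u v) (A v u)

/-- The set `s` carries a Hamiltonian directed cycle. -/
def HamOn {V : Type*} (A : V → V → Prop) (s : Set V) : Prop :=
  ∃ n : ℕ, 2 ≤ n ∧ ∃ z : ZMod n → V, Function.Injective z ∧
    (∀ i, A (z i) (z (i + 1))) ∧ Set.range z = s

/-- An exterior arc: an arc between vertices lying in different parts. -/
def ExtArc {V ι : Type*} (A : V → V → Prop) (S : ι → Set V) (u v : V) : Prop :=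
  A u v ∧ ∃ i j, i ≠ j ∧ u ∈ S i ∧ v ∈ S j

/-- A good cycle: an anti-directed 4-cycle v₀v₁v₂v₃v₀ with
{(v₀,v₁),(v₂,v₃)} ⊆ E_⊕ or {(v₂,v₁),(v₀,v₃)} ⊆ E_⊕. -/
def GoodCycle {V ι : Type*} (A : V → V → Prop) (S : ι → Set V) : Prop :=
  ∃ v₀ v₁ v₂ v₃ : V, List.Pairwise (· ≠ ·) [v₀, v₁, v₂, v₃] ∧
    A v₀ v₁ ∧ A v₂ v₁ ∧ A v₂ v₃ ∧ A v₀ v₃ ∧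
    ((ExtArc A S v₀ v₁ ∧ ExtArc A S v₂ v₃) ∨ (ExtArc A S v₂ v₁ ∧ ExtArc A S v₀ v₃))


/-- Transport of a cycle through an injective homomorphism. -/
lemma CycleThru.map {W V : Type*} {B : W → W → Prop} {A : V → V → Prop} {t : ℕ} {x : W}
    (h : CycleThru B t x) (f : W → V) (hf : Function.Injective f)
    (hB : ∀ x y, B x y → A (f x) (f y)) : CycleThru A t (f x) := by
  obtain ⟨z, hz, ha, i, hi⟩ := h
  exact ⟨fun j => f (z j), hf.comp hz, fun j => hB _ _ (ha j), i, by simp [hi]⟩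

/-- A cycle given by a sequence indexed by natural numbers. -/
lemma cycleThru_of_seq {V : Type*} {A : V → V → Prop} (t : ℕ) (f : ℕ → V) (v : V)
    (hinj : ∀ i j, i ≤ t → j ≤ t → f i = f j → i = j)
    (hstep : ∀ i, i < t → A (f i) (f (i + 1))) (hlast : A (f t) (f 0))
    (hv : ∃ i, i ≤ t ∧ f i = v) : CycleThru A (t + 1) v := by
  refine ⟨fun i => f i.val, ?_, ?_, ?_⟩
  · intro i j h
    have hi := ZMod.val_lt i
    have hj := ZMod.val_lt j
    exact ZMod.val_injective _ (hinj _ _ (by omega) (by omega) h)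
  · intro i
    have hi := ZMod.val_lt i
    have hs : (i + 1).val = (i.val + 1) % (t + 1) := by
      rw [ZMod.val_add, ZMod.val_one_eq_one_mod, Nat.add_mod_mod]
    change A (f i.val) (f (i + 1).val)
    rw [hs]
    rcases Nat.lt_or_ge i.val t with h | h
    · rw [Nat.mod_eq_of_lt (by omega)]
      exact hstep _ h
    · have : i.val = t := by omega
      rw [this, Nat.mod_self]
      exact hlast
  · obtain ⟨i, hi, h⟩ := hv
    exact ⟨(i : ZMod (t + 1)), by
      change f (ZMod.val _) = v
      rw [ZMod.val_natCast, Nat.mod_eq_of_lt (by omega)]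
      exact h⟩

/-- Two disjoint directed cycles `u`, `v` (indexed periodically by integers) such that the
orientation of the arc between `u a` and `v b` depends only on `a + b`. -/
structure CycPair {V : Type*} (A : V → V → Prop) (n m : ℕ) (u v : ℤ → V) (P : ℤ → Prop) :
    Prop where
  hu : ∀ a b, u a = u b ↔ (n : ℤ) ∣ a - b
  hv : ∀ a b, v a = v b ↔ (m : ℤ) ∣ a - b
  huv : ∀ a b, u a ≠ v b
  au : ∀ a, A (u a) (u (a + 1))
  av : ∀ a, A (v a) (v (a + 1))
  auv : ∀ a b, P (a + b) → A (u a) (v b)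
  avu : ∀ a b, ¬ P (a + b) → A (v b) (u a)
  pn : ∀ s, P (s + n) ↔ P s
  pm : ∀ s, P (s + m) ↔ P s
  kp : ∀ p e d, ¬ (m : ℤ) ∣ e → ¬ (n : ℤ) ∣ d → ¬ (P p ∧ P (p + e) ∧ P (p + d) ∧ P (p + e + d))
  kq : ∀ p e d, ¬ (m : ℤ) ∣ e → ¬ (n : ℤ) ∣ d →
    ¬ (¬ P p ∧ ¬ P (p + e) ∧ ¬ P (p + d) ∧ ¬ P (p + e + d))
  ep : ∃ s, P s
  eq : ∃ s, ¬ P s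
  n2 : 2 ≤ n
  m2 : 2 ≤ m

namespace CycPair

variable {V : Type*} {A : V → V → Prop} {n m : ℕ} {u v : ℤ → V} {P : ℤ → Prop}

lemma swap (h : CycPair A n m u v P) : CycPair A m n v u (fun s => ¬ P s) where
  hu := h.hv
  hv := h.hu
  huv := fun a b e => h.huv b a e.symm
  au := h.av
  av := h.au
  auv := fun a b e => h.avu b a (by rwa [add_comm])
  avu := fun a b e => h.auv b a (by rw [add_comm]; exact not_not.1 e)
  pn := fun s => by rw [h.pm]
  pm := fun s => by rw [h.pn]
  kp := fun p e d he hd ⟨h1, h2, h3, h4⟩ =>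
    h.kq p d e hd he ⟨h1, h3, h2, by rwa [add_right_comm]⟩
  kq := fun p e d he hd ⟨h1, h2, h3, h4⟩ =>
    h.kp p d e hd he ⟨not_not.1 h1, not_not.1 h3, not_not.1 h2, by
      rw [add_right_comm]; exact not_not.1 h4⟩
  ep := h.eq
  eq := by obtain ⟨s, hs⟩ := h.ep; exact ⟨s, not_not.2 hs⟩
  n2 := h.m2
  m2 := h.n2

lemma shift (h : CycPair A n m u v P) (c : ℤ) :
    CycPair A n m (fun a => u (a + c)) v (fun s => P (s + c)) where
  hu := fun a b => by rw [h.hu]; simp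
  hv := h.hv
  huv := fun a b => h.huv _ _
  au := fun a => by simpa [add_right_comm] using h.au (a + c)
  av := h.av
  auv := fun a b e => h.auv _ _ (by rwa [add_right_comm])
  avu := fun a b e => h.avu _ _ (by rwa [add_right_comm])
  pn := fun s => by rw [add_right_comm, h.pn]
  pm := fun s => by rw [add_right_comm, h.pm]
  kp := fun p e d he hd ⟨h1, h2, h3, h4⟩ => h.kp (p + c) e d he hd
    ⟨h1, by convert h2 using 1; ring, by convert h3 using 1; ring, by convert h4 using 1; ring⟩
  kq := fun p e d he hd ⟨h1, h2, h3, h4⟩ => h.kq (p + c) e d he hd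
    ⟨h1, by convert h2 using 2; ring, by convert h3 using 2; ring, by convert h4 using 2; ring⟩
  ep := by obtain ⟨s, hs⟩ := h.ep; exact ⟨s - c, by simpa using hs⟩
  eq := by obtain ⟨s, hs⟩ := h.eq; exact ⟨s - c, by simpa using hs⟩
  n2 := h.n2
  m2 := h.m2

/-- If `n ≥ 3` then `m ∣ n`. -/
lemma dvd (h : CycPair A n m u v P) (hn : 3 ≤ n) : m ∣ n := by
  by_contra hd
  have hd' : ¬ (m : ℤ) ∣ (n : ℤ) := by exact_mod_cast hd
  have key : ∀ s d, ¬ (n : ℤ) ∣ d → ¬ (P s ∧ P (s + d)) ∧ ¬ (¬ P s ∧ ¬ P (s + d)) := by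
    intro s d hdd
    constructor
    · rintro ⟨h1, h2⟩
      exact h.kp s n d hd' hdd ⟨h1, (h.pn s).2 h1, h2, by rw [add_right_comm, h.pn]; exact h2⟩
    · rintro ⟨h1, h2⟩
      exact h.kq s n d hd' hdd
        ⟨h1, by rwa [h.pn s], h2, by rw [add_right_comm, h.pn]; exact h2⟩
  have n1 : ¬ (n : ℤ) ∣ 1 := fun e => by have := Int.le_of_dvd (by norm_num) e; omega
  have n2 : ¬ (n : ℤ) ∣ 2 := fun e => by have := Int.le_of_dvd (by norm_num) e; omega
  have h1 := key 0 1 n1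
  have h2 := key 1 1 n1
  have h3 := key 0 2 n2
  norm_num at h1 h2 h3
  tauto

lemma le_four (h : CycPair A n n u v P) : n ≤ 4 := by
  by_contra hlt
  have k : ∀ p e d : ℤ, ¬ (n : ℤ) ∣ e → ¬ (n : ℤ) ∣ d →
      ¬ (P p ∧ P (p + e) ∧ P (p + d) ∧ P (p + e + d)) ∧
      ¬ (¬ P p ∧ ¬ P (p + e) ∧ ¬ P (p + d) ∧ ¬ P (p + e + d)) :=
    fun p e d he hd => ⟨h.kp p e d he hd, h.kq p e d he hd⟩
  have hp := h.pn
  rcases Nat.lt_or_ge n 8 with h8 | h8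
  · have h567 : n = 5 ∨ n = 6 ∨ n = 7 := by omega
    rcases h567 with rfl | rfl | rfl
    all_goals
      have e0 := hp 0
      have e1 := hp 1
      have e2 := hp 2
      have e3 := hp 3
      have e4 := hp 4
      norm_num at e0 e1 e2 e3 e4
    · have c0 := k 2 (1) 1 (by norm_num) (by norm_num)
      have c1 := k 1 (2) 3 (by norm_num) (by norm_num)
      have c2 := k 2 (2) 2 (by norm_num) (by norm_num)
      have c3 := k 1 (1) 1 (by norm_num) (by norm_num)
      have c4 := k 3 (1) 1 (by norm_num) (by norm_num)
      have c5 := k 0 (2) 2 (by norm_num) (by norm_num)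
      have c6 := k 0 (2) 3 (by norm_num) (by norm_num)
      have c7 := k 0 (1) 4 (by norm_num) (by norm_num)
      have c8 := k 1 (2) 2 (by norm_num) (by norm_num)
      have c9 := k 0 (1) 1 (by norm_num) (by norm_num)
      norm_num at c0 c1 c2 c3 c4 c5 c6 c7 c8 c9
      clear k hp
      grind
    · have c0 := k 2 (1) 1 (by norm_num) (by norm_num)
      have c1 := k 1 (3) 3 (by norm_num) (by norm_num)
      have c2 := k 1 (1) 1 (by norm_num) (by norm_num)
      have c3 := k 0 (3) 3 (by norm_num) (by norm_num)
      have c4 := k 0 (2) 2 (by norm_num) (by norm_num)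
      have c5 := k 0 (1) 1 (by norm_num) (by norm_num)
      norm_num at c0 c1 c2 c3 c4 c5
      clear k hp
      grind
    · have c0 := k 2 (2) 2 (by norm_num) (by norm_num)
      have c1 := k 1 (3) 4 (by norm_num) (by norm_num)
      have c2 := k 1 (1) 1 (by norm_num) (by norm_num)
      have c3 := k 3 (2) 2 (by norm_num) (by norm_num)
      have c4 := k 0 (3) 4 (by norm_num) (by norm_num)
      have c5 := k 0 (2) 5 (by norm_num) (by norm_num)
      have c6 := k 0 (2) 2 (by norm_num) (by norm_num)
      have c7 := k 0 (1) 6 (by norm_num) (by norm_num)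
      have c8 := k 1 (3) 3 (by norm_num) (by norm_num)
      have c9 := k 0 (1) 1 (by norm_num) (by norm_num)
      norm_num at c0 c1 c2 c3 c4 c5 c6 c7 c8 c9
      clear k hp
      grind
  · have nd : ∀ x : ℤ, 0 < x → x < 8 → ¬ (n : ℤ) ∣ x := fun x hx hx' e => by
      have := Int.le_of_dvd hx e
      omega
    have c0 := k 4 1 1 (nd _ (by norm_num) (by norm_num)) (nd _ (by norm_num) (by norm_num))
    have c1 := k 3 2 2 (nd _ (by norm_num) (by norm_num)) (nd _ (by norm_num) (by norm_num))
    have c2 := k 2 1 1 (nd _ (by norm_num) (by norm_num)) (nd _ (by norm_num) (by norm_num))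
    have c3 := k 1 3 3 (nd _ (by norm_num) (by norm_num)) (nd _ (by norm_num) (by norm_num))
    have c4 := k 1 2 2 (nd _ (by norm_num) (by norm_num)) (nd _ (by norm_num) (by norm_num))
    have c5 := k 1 1 5 (nd _ (by norm_num) (by norm_num)) (nd _ (by norm_num) (by norm_num))
    have c6 := k 1 1 1 (nd _ (by norm_num) (by norm_num)) (nd _ (by norm_num) (by norm_num))
    have c7 := k 0 3 3 (nd _ (by norm_num) (by norm_num)) (nd _ (by norm_num) (by norm_num))
    have c8 := k 0 3 4 (nd _ (by norm_num) (by norm_num)) (nd _ (by norm_num) (by norm_num))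
    have c9 := k 0 2 5 (nd _ (by norm_num) (by norm_num)) (nd _ (by norm_num) (by norm_num))
    have c10 := k 0 2 2 (nd _ (by norm_num) (by norm_num)) (nd _ (by norm_num) (by norm_num))
    have c11 := k 0 1 4 (nd _ (by norm_num) (by norm_num)) (nd _ (by norm_num) (by norm_num))
    have c12 := k 0 1 3 (nd _ (by norm_num) (by norm_num)) (nd _ (by norm_num) (by norm_num))
    have c13 := k 0 1 1 (nd _ (by norm_num) (by norm_num)) (nd _ (by norm_num) (by norm_num))
    norm_num at c0 c1 c2 c3 c4 c5 c6 c7 c8 c9 c10 c11 c12 c13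
    clear k hp nd h
    by_cases g0 : P 0 <;> by_cases g1 : P 1 <;> by_cases g2 : P 2 <;> by_cases g3 : P 3 <;>
      by_cases g4 : P 4 <;> grind


end CycPair


/-- Model digraph on two cycles of length `n`. -/
def Model (n : ℕ) (Q : ZMod n → Bool) (x y : Bool × ZMod n) : Prop :=
  (x.1 = y.1 ∧ y.2 = x.2 + 1) ∨ (x.1 = false ∧ y.1 = true ∧ Q (x.2 + y.2) = true) ∨
    (x.1 = true ∧ y.1 = false ∧ Q (x.2 + y.2) = false)

instance (n : ℕ) (Q : ZMod n → Bool) (x y : Bool × ZMod n) : Decidable (Model n Q x y) := by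
  unfold Model; infer_instance

/-- Shift symmetry of the model. -/
def mshift (n : ℕ) (c : ZMod n) (x : Bool × ZMod n) : Bool × ZMod n :=
  (x.1, if x.1 then x.2 - c else x.2 + c)

lemma model_pan (n : ℕ) (Q : ZMod n → Bool) (t : ℕ)
    (h : ∃ z : ZMod t → Bool × ZMod n, Function.Injective z ∧
      (∀ i, Model n Q (z i) (z (i + 1))) ∧ (∃ i, z i = (false, 0)) ∧ ∃ i, z i = (true, 0))
    (x : Bool × ZMod n) : CycleThru (Model n Q) t x := by
  obtain ⟨z, hz, ha, h0, h1⟩ := h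
  have hinj : ∀ c, Function.Injective (mshift n c) := by
    rintro c ⟨_ | _, a⟩ ⟨_ | _, b⟩ h <;> simp_all [mshift]
  have hhom : ∀ c x y, Model n Q x y → Model n Q (mshift n c x) (mshift n c y) := by
    rintro c ⟨_ | _, a⟩ ⟨_ | _, b⟩ h <;> simp_all [mshift, Model]
    · ring
    · ring
  rcases x with ⟨_ | _, a⟩
  · have := CycleThru.map ⟨z, hz, ha, h0⟩ (mshift n a) (hinj a) (hhom a)
    simpa [mshift] using this
  · have := CycleThru.map ⟨z, hz, ha, h1⟩ (mshift n (-a)) (hinj _) (hhom _)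
    simpa [mshift] using this

lemma model_3 (t : ℕ) (h3 : 3 ≤ t) (ht : t ≤ 6) (x : Bool × ZMod 3) :
    CycleThru (Model 3 (fun s => decide (s = 0))) t x := by
  apply model_pan
  interval_cases t
  · exact ⟨fun i : ZMod 3 => [(false, 0), (true, 0), (false, 2)].getD i.val (false, 0),
      by decide, by decide, by decide, by decide⟩
  · exact ⟨fun i : ZMod 4 => [(false, 0), (true, 0), (false, 1), (false, 2)].getD i.val (false, 0),
      by decide, by decide, by decide, by decide⟩
  · exact ⟨fun i : ZMod 5 => [(false, 0), (false, 1), (true, 2), (true, 0), (false, 2)].getD i.val (false, 0),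
      by decide, by decide, by decide, by decide⟩
  · exact ⟨fun i : ZMod 6 => [(false, 0), (false, 1), (true, 2), (true, 0), (false, 2), (true, 1)].getD i.val (false, 0),
      by decide, by decide, by decide, by decide⟩

lemma model_4 (t : ℕ) (h3 : 3 ≤ t) (ht : t ≤ 8) (x : Bool × ZMod 4) :
    CycleThru (Model 4 (fun s => decide (s = 0 ∨ s = 1))) t x := by
  apply model_pan
  interval_cases t
  · exact ⟨fun i : ZMod 3 => [(false, 0), (true, 0), (false, 3)].getD i.val (false, 0),
      by decide, by decide, by decide, by decide⟩
  · exact ⟨fun i : ZMod 4 => [(false, 0), (false, 1), (true, 0), (false, 3)].getD i.val (false, 0),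
      by decide, by decide, by decide, by decide⟩
  · exact ⟨fun i : ZMod 5 => [(false, 0), (false, 1), (true, 0), (false, 2), (false, 3)].getD i.val (false, 0),
      by decide, by decide, by decide, by decide⟩
  · exact ⟨fun i : ZMod 6 => [(false, 0), (false, 1), (false, 2), (true, 3), (true, 0), (false, 3)].getD i.val (false, 0),
      by decide, by decide, by decide, by decide⟩
  · exact ⟨fun i : ZMod 7 => [(false, 0), (false, 1), (false, 2), (true, 2), (true, 3), (true, 0), (false, 3)].getD i.val (false, 0),
      by decide, by decide, by decide, by decide⟩
  · exact ⟨fun i : ZMod 8 => [(false, 0), (false, 1), (false, 2), (true, 3), (true, 0), (false, 3), (true, 1), (true, 2)].getD i.val (false, 0),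
      by decide, by decide, by decide, by decide⟩

namespace CycPair

variable {V : Type*} {A : V → V → Prop} {n m : ℕ} {u v : ℤ → V} {P : ℤ → Prop}

/-- Pancyclicity transfers from the model. -/
lemma of_model [NeZero n] (h : CycPair A n n u v P) (Q : ZMod n → Bool)
    (hQ : ∀ s : ℤ, P s ↔ Q s = true) (t : ℕ) (hm : ∀ x, CycleThru (Model n Q) t x) :
    ∀ a, CycleThru A t (u a) ∧ CycleThru A t (v a) := by
  have hc : ∀ a b : ℤ, ((a : ZMod n) = b) ↔ (n : ℤ) ∣ a - b := by
    intro a b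
    rw [← sub_eq_zero, ← Int.cast_sub, ZMod.intCast_zmod_eq_zero_iff_dvd]
  have lift : ∀ x : ZMod n, ∃ a : ℤ, (a : ZMod n) = x := ZMod.intCast_surjective
  choose r hr using lift
  have ru : ∀ a : ℤ, u (r a) = u a := fun a => by rw [h.hu, ← hc, hr]
  have rv : ∀ a : ℤ, v (r a) = v a := fun a => by rw [h.hv, ← hc, hr]
  let f : Bool × ZMod n → V := fun x => if x.1 then v (r x.2) else u (r x.2)
  have hf : Function.Injective f := by
    rintro ⟨_ | _, a⟩ ⟨_ | _, b⟩ e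
    · have e : u (r a) = u (r b) := e
      rw [h.hu, ← hc, hr, hr] at e
      rw [e]
    · exact absurd e (h.huv _ _)
    · exact absurd (Eq.symm e) (h.huv _ _)
    · have e : v (r a) = v (r b) := e
      rw [h.hv, ← hc, hr, hr] at e
      rw [e]
  have hB : ∀ x y, Model n Q x y → A (f x) (f y) := by
    rintro ⟨_ | _, a⟩ ⟨_ | _, b⟩ e <;> simp [Model] at e
    · have : u (r b) = u (r a + 1) := by rw [h.hu, ← hc]; push_cast; rw [hr, hr, e]
      show A (u (r a)) (u (r b))
      rw [this]
      exact h.au _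
    · show A (u (r a)) (v (r b))
      apply h.auv
      rw [hQ]; push_cast; rw [hr, hr, e]
    · show A (v (r a)) (u (r b))
      apply h.avu
      rw [hQ]; push_cast; rw [hr, hr, add_comm, e]; simp
    · have : v (r b) = v (r a + 1) := by rw [h.hv, ← hc]; push_cast; rw [hr, hr, e]
      show A (v (r a)) (v (r b))
      rw [this]
      exact h.av _
  intro a
  constructor
  · have := (hm (false, (a : ZMod n))).map f hf hB
    simpa [f, ru] using this
  · have := (hm (true, (a : ZMod n))).map f hf hB
    simpa [f, rv] using this

/-- There is a place where `P` switches from false to true. -/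
lemma switch (h : CycPair A n m u v P) : ∃ s, ¬ P (s - 1) ∧ P s := by
  by_contra hc
  push Not at hc
  obtain ⟨s, hs⟩ := h.eq
  obtain ⟨p, hp⟩ := h.ep
  have h1 : ∀ k : ℕ, ¬ P (s + k) := by
    intro k
    induction k with
    | zero => simpa using hs
    | succ k ih =>
      apply hc
      convert ih using 2
      push_cast; ring
  have h2 : ∀ k : ℕ, P (p + k * n) := by
    intro k
    induction k with
    | zero => simpa using hp
    | succ k ih =>
      rw [← h.pn] at ih
      convert ih using 1
      push_cast; ring
  have hn := h.n2
  have h3 : 0 ≤ p + (s - p).natAbs * n - s := by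
    have : ((s - p).natAbs : ℤ) * 1 ≤ (s - p).natAbs * n := by
      apply mul_le_mul_of_nonneg_left <;> omega
    omega
  have h4 := h1 (p + (s - p).natAbs * n - s).toNat
  rw [Int.toNat_of_nonneg h3] at h4
  apply h4
  convert h2 (s - p).natAbs using 1
  ring

lemma mul_per (h : CycPair A n m u v P) (s k : ℤ) : P (s + k * n) ↔ P s := by
  induction k using Int.induction_on with
  | zero => simp
  | succ k ih => rw [← ih, ← h.pn (s + k * n)]; ring_nf
  | pred k ih => rw [← ih, ← h.pn (s + (-k - 1) * n)]; ring_nf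

lemma emod_per (h : CycPair A n m u v P) (s : ℤ) : P s ↔ P (s % n) := by
  rw [← h.mul_per (s % n) (s / n)]
  have := Int.emod_add_mul_ediv s n
  rw [mul_comm (s / n), this]

lemma pan3' (h : CycPair A 3 3 u v P) (h0 : P 0) (h1 : ¬ P 1) (h2 : ¬ P 2) (t : ℕ) (ht : 3 ≤ t)
    (ht' : t ≤ 6) : ∀ a, CycleThru A t (u a) ∧ CycleThru A t (v a) := by
  refine h.of_model (fun s => decide (s = 0)) ?_ t (model_3 t ht ht')
  intro s
  rw [h.emod_per, decide_eq_true_iff, ZMod.intCast_zmod_eq_zero_iff_dvd]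
  push_cast
  have : s % 3 = 0 ∨ s % 3 = 1 ∨ s % 3 = 2 := by omega
  rcases this with e | e | e <;> rw [e] <;> simp only [h0, h1, h2, true_iff, false_iff] <;> omega

lemma pan3 (h : CycPair A 3 3 u v P) (t : ℕ) (ht : 3 ≤ t) (ht' : t ≤ 6) :
    ∀ a, CycleThru A t (u a) ∧ CycleThru A t (v a) := by
  obtain ⟨s, hs1, hs⟩ := h.switch
  intro a
  have e2 : ¬ P (s + 2) := by
    rw [← h.pn] at hs1
    convert hs1 using 2
    push_cast; ring
  by_cases h1 : P (s + 1)
  · have g := (h.swap).shift (s + 2)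
    have := g.pan3' (by simpa using e2) (by
      rw [not_not, show (1 : ℤ) + (s + 2) = s + (3 : ℕ) by push_cast; ring, h.pn]; exact hs)
      (by rw [not_not, show (2 : ℤ) + (s + 2) = s + 1 + (3 : ℕ) by push_cast; ring, h.pn]
          exact h1) t ht ht'
    exact ⟨(this a).2, by simpa using (this (a - (s + 2))).1⟩
  · have g := h.shift s
    have := g.pan3' (by simpa using hs) (by rwa [add_comm]) (by rwa [add_comm]) t ht ht'
    exact ⟨by simpa using (this (a - s)).1, (this a).2⟩

lemma pan4' (h : CycPair A 4 4 u v P) (h0 : P 0) (h1 : P 1) (h2 : ¬ P 2) (h3 : ¬ P 3) (t : ℕ)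
    (ht : 3 ≤ t) (ht' : t ≤ 8) : ∀ a, CycleThru A t (u a) ∧ CycleThru A t (v a) := by
  refine h.of_model (fun s => decide (s = 0 ∨ s = 1)) ?_ t (model_4 t ht ht')
  intro s
  have e1 : ((s : ZMod 4) = 1) ↔ ((s - 1 : ℤ) : ZMod 4) = 0 := by
    push_cast; rw [sub_eq_zero]
  rw [h.emod_per, decide_eq_true_iff, e1, ZMod.intCast_zmod_eq_zero_iff_dvd,
    ZMod.intCast_zmod_eq_zero_iff_dvd]
  push_cast
  have : s % 4 = 0 ∨ s % 4 = 1 ∨ s % 4 = 2 ∨ s % 4 = 3 := by omega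
  rcases this with e | e | e | e <;> rw [e] <;> simp only [h0, h1, h2, h3, true_iff, false_iff] <;> omega

lemma pan4 (h : CycPair A 4 4 u v P) (t : ℕ) (ht : 3 ≤ t) (ht' : t ≤ 8) :
    ∀ a, CycleThru A t (u a) ∧ CycleThru A t (v a) := by
  obtain ⟨s, hs1, hs⟩ := h.switch
  intro a
  have g := h.shift s
  have g0 : P (0 + s) := by simpa using hs
  have g3 : ¬ P (3 + s) := by
    rw [← h.pn] at hs1
    convert hs1 using 2
    push_cast; ring
  have k1 := g.kp 0 1 1 (by norm_num) (by norm_num)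
  have k2 := g.kp 0 2 2 (by norm_num) (by norm_num)
  have k3 := g.kq 1 1 1 (by norm_num) (by norm_num)
  have p4 := g.pn 0
  norm_num at k1 k2 k3 p4
  have g2 : ¬ P (2 + s) := by
    intro e
    exact k2 hs e (p4.2 hs)
  have g1 : P (1 + s) := by
    by_contra e
    exact g3 (k3 e g2)
  have := g.pan4' g0 g1 g2 g3 t ht ht'
  exact ⟨by simpa using (this (a - s)).1, (this a).2⟩

/-- The case where the first cycle has length two: a cycle through `u a` and `v x`. -/
lemma pan2' (h : CycPair A 2 m u v P) (a x : ℤ) (hx : P (a + x)) (t : ℕ) (ht : 3 ≤ t)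
    (ht' : t ≤ m + 2) : CycleThru A t (u a) ∧ CycleThru A t (v x) := by
  have par : ∀ s k : ℤ, P (s + 2 * k) ↔ P s := fun s k => by
    have := h.mul_per s k
    rwa [mul_comm] at this
  have alt : ∀ s, P s → ¬ P (s + 1) := by
    intro s h1 h2
    obtain ⟨q, hq⟩ := h.eq
    obtain ⟨k, hk⟩ : ∃ k, q = s + 2 * k ∨ q = s + 1 + 2 * k := ⟨(q - s) / 2, by omega⟩
    rcases hk with rfl | rfl
    · exact hq ((par _ _).2 h1)
    · exact hq ((par _ _).2 h2)
  have hev : ∃ j, m = 2 * j := by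
    by_contra hne
    obtain ⟨j, hj⟩ : ∃ j, m = 2 * j + 1 := ⟨m / 2, by
      by_contra hc
      exact hne ⟨m / 2, by omega⟩⟩
    have h1 := (h.pm _).2 hx
    rw [hj] at h1
    apply alt _ hx
    rw [← par _ (j : ℤ)]
    convert h1 using 1
    push_cast; ring
  obtain ⟨j, hj⟩ := hev
  have vinj : ∀ b c : ℤ, |b - c| < m → v b = v c → b = c := by
    intro b c hbc e
    rw [h.hv] at e
    have := Int.eq_zero_of_abs_lt_dvd e hbc
    omega
  have hodd : ∀ k : ℤ, ¬ P (a + x + 1 + 2 * k) := fun k => by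
    rw [par]; exact alt _ hx
  have heven : ∀ k : ℤ, P (a + x + 2 * k) := fun k => by
    rw [par]; exact hx
  have hu1 : u a ≠ u (a + 1) := by
    rw [Ne, h.hu]; norm_num
  obtain ⟨l, hl⟩ : ∃ l, t = 2 * l + 1 ∨ t = 2 * l + 1 + 1 := ⟨(t - 1) / 2, by omega⟩
  rcases hl with rfl | rfl
  · let f : ℕ → V := fun i => if i = 0 then u a else v (x + i - 1)
    have f0 : f 0 = u a := rfl
    have fs : ∀ i, i ≠ 0 → f i = v (x + i - 1) := fun i hi => if_neg hi
    have main : ∀ w, (∃ i, i ≤ 2 * l ∧ f i = w) → CycleThru A (2 * l + 1) w := by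
      intro w hw
      refine cycleThru_of_seq (2 * l) f w ?_ ?_ ?_ hw
      · intro b c hb hc e
        by_cases b0 : b = 0 <;> by_cases c0 : c = 0
        · omega
        · rw [b0, f0, fs c c0] at e
          exact absurd e (h.huv _ _)
        · rw [c0, f0, fs b b0] at e
          exact absurd e.symm (h.huv _ _)
        · rw [fs b b0, fs c c0] at e
          have := vinj _ _ (by rw [abs_lt]; omega) e
          omega
      · intro b hb
        by_cases b0 : b = 0
        · subst b0
          rw [f0, fs _ (by omega)]
          apply h.auv
          simpa using hx
        · rw [fs b b0, fs _ (by omega)]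
          have := h.av (x + b - 1)
          convert this using 2
          push_cast; ring
      · rw [f0, fs _ (by omega)]
        apply h.avu
        have := hodd (l - 1)
        convert this using 2
        push_cast; ring
    exact ⟨main _ ⟨0, by omega, f0⟩, main _ ⟨1, by omega, by rw [fs 1 (by omega)]; simp⟩⟩
  · let f : ℕ → V := fun i => if i = 0 then u a else if i = 1 then v x else
      if i = 2 then u (a + 1) else v (x + i - 2)
    have f0 : f 0 = u a := rfl
    have f1 : f 1 = v x := rfl
    have f2 : f 2 = u (a + 1) := rfl
    have fs : ∀ i, 3 ≤ i → f i = v (x + i - 2) := fun i hi => by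
      simp only [f]
      rw [if_neg (by omega), if_neg (by omega), if_neg (by omega)]
    have main : ∀ w, (∃ i, i ≤ 2 * l + 1 ∧ f i = w) → CycleThru A (2 * l + 1 + 1) w := by
      intro w hw
      refine cycleThru_of_seq (2 * l + 1) f w ?_ ?_ ?_ hw
      · have aux : ∀ b c, b < c → c ≤ 2 * l + 1 → f b ≠ f c := by
          intro b c hbc hc e
          have hc' : c = 1 ∨ c = 2 ∨ 3 ≤ c := by omega
          have hb' : b = 0 ∨ b = 1 ∨ b = 2 ∨ 3 ≤ b := by omega
          rcases hc' with rfl | rfl | hc3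
          · have : b = 0 := by omega
            subst this
            exact h.huv _ _ e
          · have : b = 0 ∨ b = 1 := by omega
            rcases this with rfl | rfl
            · exact hu1 e
            · exact h.huv _ _ e.symm
          · rw [fs c hc3] at e
            rcases hb' with rfl | rfl | rfl | hb3
            · exact h.huv _ _ e
            · rw [f1] at e
              have := vinj _ _ (by rw [abs_lt]; omega) e
              omega
            · exact h.huv _ _ e
            · rw [fs b hb3] at e
              have := vinj _ _ (by rw [abs_lt]; omega) e
              omega
        intro b c hb hc e
        rcases lt_trichotomy b c with hlt | heq | hlt
        · exact absurd e (aux _ _ hlt hc)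
        · exact heq
        · exact absurd e.symm (aux _ _ hlt hb)
      · intro b hb
        have hb' : b = 0 ∨ b = 1 ∨ b = 2 ∨ 3 ≤ b := by omega
        rcases hb' with rfl | rfl | rfl | hb3
        · exact h.auv _ _ hx
        · apply h.avu
          have := hodd 0
          convert this using 2
          ring
        · rw [f2, fs _ (by omega)]
          apply h.auv
          have := heven 1
          convert this using 1
          push_cast; ring
        · rw [fs b hb3, fs _ (by omega)]
          have := h.av (x + b - 2)
          convert this using 2
          push_cast; ring
      · rw [f0, fs _ (by omega)]
        apply h.avu
        have := hodd (l - 1)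
        convert this using 2
        push_cast; ring
    exact ⟨main _ ⟨0, by omega, f0⟩, main _ ⟨1, by omega, f1⟩⟩

lemma pan2 (h : CycPair A 2 m u v P) (t : ℕ) (ht : 3 ≤ t) (ht' : t ≤ m + 2) :
    ∀ a, CycleThru A t (u a) ∧ CycleThru A t (v a) := by
  obtain ⟨p, hp⟩ := h.ep
  intro a
  exact ⟨(h.pan2' a (p - a) (by simpa using hp) t ht ht').1,
    (h.pan2' (p - a) a (by simpa using hp) t ht ht').2⟩

lemma pan (h : CycPair A n m u v P) (t : ℕ) (ht : 3 ≤ t) (ht' : t ≤ n + m) :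
    ∀ a, CycleThru A t (u a) ∧ CycleThru A t (v a) := by
  have hn := h.n2
  have hm := h.m2
  rcases hn.eq_or_lt with rfl | hn3
  · exact h.pan2 t ht (by omega)
  rcases hm.eq_or_lt with rfl | hm3
  · intro a
    exact (h.swap.pan2 t ht (by omega) a).symm
  have : n = m := Nat.dvd_antisymm (h.swap.dvd hm3) (h.dvd hn3)
  subst this
  have := h.le_four
  have h34 : n = 3 ∨ n = 4 := by omega
  rcases h34 with rfl | rfl
  · exact h.pan3 t ht (by omega)
  · exact h.pan4 t ht (by omega)

end CycPair

/-- Periodic parametrization of a Hamiltonian cycle. -/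
lemma HamOn.param {V : Type*} {A : V → V → Prop} {s : Set V} (h : HamOn A s) :
    ∃ (n : ℕ) (c : ℤ → V), 2 ≤ n ∧ (∀ a b, c a = c b ↔ (n : ℤ) ∣ a - b) ∧
      (∀ a, A (c a) (c (a + 1))) ∧ Set.range c = s ∧ s.ncard = n := by
  obtain ⟨n, hn, z, hz, ha, hr⟩ := h
  refine ⟨n, fun a => z a, hn, ?_, ?_, ?_, ?_⟩
  · intro a b
    rw [hz.eq_iff, ← sub_eq_zero, ← Int.cast_sub, ZMod.intCast_zmod_eq_zero_iff_dvd]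
  · intro a
    simpa using ha a
  · rw [← hr]
    exact (ZMod.intCast_surjective (n := n)).range_comp z
  · rw [← hr, ← Set.image_univ, Set.ncard_image_of_injective _ hz, Set.ncard_univ, Nat.card_zmod]

/-- A strong generalized sum of k ≥ 2 Hamiltonian digraphs containing no good
cycle is vertex-pancyclic. -/
theorem stmt8 {V : Type*} [Fintype V] (A : V → V → Prop) {k : ℕ} (hk : 2 ≤ k)
    (S : Fin k → Set V)
    (hgs : GenSumFam A Set.univ S) (hham : ∀ i, HamOn A (S i))
    (hstrong : ∀ u v : V, u ≠ v → Relation.ReflTransGen A u v)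
    (hng : ¬ GoodCycle A S) :
    ∀ v : V, ∀ t : ℕ, 3 ≤ t → t ≤ Fintype.card V → CycleThru A t v := by
  obtain ⟨hdis, hun, hx⟩ := hgs
  choose n c hn hc ha hr hcard using fun i => (hham i).param
  have mem : ∀ i a, c i a ∈ S i := fun i a => by rw [← hr i]; exact ⟨a, rfl⟩
  have ne : ∀ i j, i ≠ j → ∀ a b, c i a ≠ c j b := fun i j hij a b e =>
    Set.disjoint_left.1 (hdis hij) (mem i a) (e ▸ mem j b)
  have tot : ∀ i j, i ≠ j → ∀ a b, ¬ A (c i a) (c j b) ↔ A (c j b) (c i a) := by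
    intro i j hij a b
    have := hx i j hij _ (mem i a) _ (mem j b)
    simp only [Xor', Xor] at this
    tauto
  have n1 : ∀ i, ¬ (n i : ℤ) ∣ 1 := fun i e => by
    have := Int.le_of_dvd (by norm_num) e
    have := hn i
    omega
  have succne : ∀ i a, c i a ≠ c i (a + 1) := fun i a e => by
    rw [hc, show a - (a + 1) = -1 by ring, Int.dvd_neg] at e
    exact n1 i e
  have ext : ∀ i j, i ≠ j → ∀ a b, A (c i a) (c j b) → ExtArc A S (c i a) (c j b) :=
    fun i j hij a b e => ⟨e, i, j, hij, mem i a, mem j b⟩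
  have good : ∀ v₀ v₁ v₂ v₃, v₀ ≠ v₁ → v₀ ≠ v₂ → v₀ ≠ v₃ → v₁ ≠ v₂ → v₁ ≠ v₃ → v₂ ≠ v₃ →
      A v₂ v₁ → A v₀ v₃ → ExtArc A S v₀ v₁ → ExtArc A S v₂ v₃ → False := by
    intro v₀ v₁ v₂ v₃ h1 h2 h3 h4 h5 h6 h7 h8 h9 h10
    exact hng ⟨v₀, v₁, v₂, v₃, by simp [*], h9.1, h7, h10.1, h8, Or.inl ⟨h9, h10⟩⟩
  -- the shift property
  have fwd : ∀ i j, i ≠ j → ∀ a b, A (c i a) (c j b) → A (c i (a + 1)) (c j (b - 1)) := by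
    intro i j hij a b e
    by_contra hne
    rw [tot i j hij] at hne
    have hs : A (c j (b - 1)) (c j b) := by simpa using ha j (b - 1)
    have hs' : c j (b - 1) ≠ c j b := by simpa using succne j (b - 1)
    exact good (c i a) (c j b) (c j (b - 1)) (c i (a + 1)) (ne i j hij _ _) (ne i j hij _ _)
      (succne i a) hs'.symm (ne j i hij.symm _ _) (ne j i hij.symm _ _) hs (ha i a)
      (ext i j hij _ _ e) (ext j i hij.symm _ _ hne)
  have fwdk : ∀ i j, i ≠ j → ∀ (q : ℕ) a b, A (c i a) (c j b) → A (c i (a + q)) (c j (b - q)) := by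
    intro i j hij q a b e
    induction q with
    | zero => simpa using e
    | succ q ih =>
      have := fwd i j hij _ _ ih
      convert this using 2
      · push_cast; ring
      · push_cast; ring
  have shiftz : ∀ i j, i ≠ j → ∀ (q : ℤ) a b, A (c i a) (c j b) →
      A (c i (a + q)) (c j (b - q)) := by
    intro i j hij q a b e
    have hi := hn i
    have hj := hn j
    have hge : 0 ≤ q + q.natAbs * (n i * n j) := by
      have h1 : (1 : ℤ) ≤ n i * n j := by
        have : (0 : ℤ) < n i * n j := by positivity
        omega
      have : (q.natAbs : ℤ) * 1 ≤ q.natAbs * (n i * n j) :=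
        mul_le_mul_of_nonneg_left h1 (by omega)
      omega
    have := fwdk i j hij (q + q.natAbs * (n i * n j)).toNat a b e
    rw [Int.toNat_of_nonneg hge] at this
    have e1 : c i (a + (q + q.natAbs * (n i * n j))) = c i (a + q) := by
      rw [hc]; exact ⟨q.natAbs * n j, by ring⟩
    have e2 : c j (b - (q + q.natAbs * (n i * n j))) = c j (b - q) := by
      rw [hc]; exact ⟨- (q.natAbs * n i), by ring⟩
    rwa [e1, e2] at this
  have dep : ∀ i j, i ≠ j → ∀ a b a' b', a + b = a' + b' →
      (A (c i a) (c j b) ↔ A (c i a') (c j b')) := by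
    intro i j hij a b a' b' e
    constructor
    · intro g
      have := shiftz i j hij (a' - a) a b g
      convert this using 2
      · ring
      · linarith
    · intro g
      have := shiftz i j hij (a - a') a' b' g
      convert this using 2
      · ring
      · linarith
  -- no complete orientation on a `K_{2,2}`
  have k22 : ∀ i j, i ≠ j → ∀ a a' b b', ¬ (n i : ℤ) ∣ a - a' → ¬ (n j : ℤ) ∣ b - b' →
      A (c i a) (c j b) → A (c i a) (c j b') → A (c i a') (c j b) → A (c i a') (c j b') →
      False := by
    intro i j hij a a' b b' h1 h2 g1 g2 g3 g4
    exact good (c i a) (c j b) (c i a') (c j b') (ne i j hij _ _) (by rwa [Ne, hc])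
      (ne i j hij _ _) (ne j i hij.symm _ _) (by rwa [Ne, hc]) (ne i j hij _ _) g3 g2
      (ext i j hij _ _ g1) (ext i j hij _ _ g4)
  have n1' : ∀ i, ¬ (n i : ℤ) ∣ 0 - 1 := fun i e => n1 i (by simpa using e)
  have exin : ∀ i j, i ≠ j → ∀ b, ∃ a, A (c i a) (c j b) := by
    intro i j hij b
    by_contra hne
    push Not at hne
    have all : ∀ a' b', A (c j b') (c i a') := by
      intro a' b'
      rw [← tot i j hij, dep i j hij a' b' (a' + b' - b) b (by ring)]
      exact hne _
    exact k22 j i hij.symm 0 1 0 1 (n1' j) (n1' i) (all _ _) (all _ _) (all _ _) (all _ _)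
  -- no three summands
  have three : ∀ i j l : Fin k, i ≠ j → i ≠ l → j ≠ l → False := by
    intro i j l hij hil hjl
    obtain ⟨a, h1⟩ := exin i l hil 0
    obtain ⟨b, h2⟩ := exin j l hjl 0
    have key : ∀ i j, i ≠ j → i ≠ l → j ≠ l → ∀ a b, A (c i a) (c l 0) → A (c j b) (c l 0) →
        A (c i (a + 1)) (c j b) := by
      intro i j hij hil hjl a b h1 h2
      by_contra hne
      rw [tot i j hij] at hne
      exact good (c i a) (c l 0) (c j b) (c i (a + 1)) (ne i l hil _ _) (ne i j hij _ _)
        (succne i a) (ne l j hjl.symm _ _) (ne l i hil.symm _ _) (ne j i hij.symm _ _) h2 (ha i a)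
        (ext i l hil _ _ h1) (ext j i hij.symm _ _ hne)
    have g1 := key i j hij hil hjl a b h1 h2
    have g2 := key j i hij.symm hjl hil b a h2 h1
    rw [← tot i j hij] at g2
    exact g2 ((dep i j hij _ _ _ _ (by ring)).1 g1)
  have hk2 : k = 2 := by
    by_contra hne
    exact three ⟨0, by omega⟩ ⟨1, by omega⟩ ⟨2, by omega⟩ (by simp) (by simp) (by simp)
  subst hk2
  have h01 : (0 : Fin 2) ≠ 1 := by decide
  have hpair : CycPair A (n 0) (n 1) (c 0) (c 1) (fun s => A (c 0 0) (c 1 s)) :=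
    { hu := hc 0
      hv := hc 1
      huv := ne 0 1 h01
      au := ha 0
      av := ha 1
      auv := fun a b e => (dep 0 1 h01 _ _ _ _ (by ring)).1 e
      avu := fun a b e => by
        rw [← tot 0 1 h01, dep 0 1 h01 a b 0 (a + b) (by ring)]
        exact e
      pn := fun s => by
        rw [dep 0 1 h01 0 (s + n 0) (n 0) s (by ring)]
        have : c 0 (n 0) = c 0 0 := by rw [hc]; simp
        rw [this]
      pm := fun s => by
        have : c 1 (s + n 1) = c 1 s := by rw [hc]; simp
        rw [this]
      kp := by
        rintro p e d he hd ⟨h1, h2, h3, h4⟩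
        refine k22 0 1 h01 0 d p (p + e) (by simpa using hd) (by simpa using he) h1 h2 ?_ ?_
        · exact (dep 0 1 h01 _ _ _ _ (by ring)).1 h3
        · exact (dep 0 1 h01 _ _ _ _ (by ring)).1 h4
      kq := by
        rintro p e d he hd ⟨h1, h2, h3, h4⟩
        rw [dep 0 1 h01 0 (p + d) d p (by ring)] at h3
        rw [dep 0 1 h01 0 (p + e + d) d (p + e) (by ring)] at h4
        rw [tot 0 1 h01] at h1 h2 h3 h4
        exact k22 1 0 h01.symm p (p + e) 0 d (by simpa using he) (by simpa using hd) h1 h3 h2 h4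
      ep := by
        obtain ⟨a, h⟩ := exin 0 1 h01 0
        exact ⟨a, (dep 0 1 h01 _ _ _ _ (by ring)).1 h⟩
      eq := by
        obtain ⟨a, h⟩ := exin 1 0 h01.symm 0
        exact ⟨a, (tot 0 1 h01 _ _).2 h⟩
      n2 := hn 0
      m2 := hn 1 }
  have huniv : S 0 ∪ S 1 = Set.univ := by
    rw [← hun]
    ext x
    simp [Fin.exists_fin_two]
  have hcardV : Fintype.card V = n 0 + n 1 := by
    rw [← Nat.card_eq_fintype_card, ← Set.ncard_univ, ← huniv,
      Set.ncard_union_eq (hdis h01), hcard, hcard]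
  intro v t ht ht'
  have hv : v ∈ S 0 ∪ S 1 := by rw [huniv]; trivial
  have hp := hpair.pan t ht (by omega)
  rcases hv with hv | hv
  · rw [← hr] at hv
    obtain ⟨a, rfl⟩ := hv
    exact (hp a).1
  · rw [← hr] at hv
    obtain ⟨a, rfl⟩ := hv
    exact (hp a).2
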